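/- arXiv:1703.08712 — 10 statements merged into one kernel-verified Lean document; each statement's English description precedes it below -/
import Mathlib

section
/- Let V be a v-dimensional vector space over a field, let C be a set of k-dimensional subspaces of V whose pairwise subspace distances are all at least d, and let X be a subspace of V of dimension a with a < k. Let π : V → V/X be the quotient map and set C' = { π(U) : U ∈ C, X ≤ U }. Then every member of C' is a (k − a)-dimensional subspace of V/X, any two distinct members of C' have subspace distance at least d, and |C'| = #{U ∈ C : X ≤ U}. -/
open Module

/-- The subspace distance `d_s(U,W) = dim(U + W) - dim(U ∩ W)`. -/
noncomputable def sDist {K V : Type*} [DivisionRing K] [AddCommGroup V] [Module K V]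
    (U W : Submodule K V) : ℕ :=
  finrank K ↥(U ⊔ W) - finrank K ↥(U ⊓ W)

namespace Submodule

variable {K V : Type*} [Field K] [AddCommGroup V] [Module K V]

theorem comap_map_mkQ_of_le {X U : Submodule K V} (h : X ≤ U) :
    (U.map X.mkQ).comap X.mkQ = U := by
  rw [comap_map_mkQ, sup_eq_right.mpr h]

theorem injOn_map_mkQ (X : Submodule K V) : Set.InjOn (map X.mkQ) {U | X ≤ U} :=
  fun U hU W hW h => by
    rw [← comap_map_mkQ_of_le hU, h, comap_map_mkQ_of_le hW]

theorem map_mkQ_inf {X U W : Submodule K V} (hU : X ≤ U) (hW : X ≤ W) :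
    (U ⊓ W).map X.mkQ = U.map X.mkQ ⊓ W.map X.mkQ := by
  conv_lhs => rw [← comap_map_mkQ_of_le hU, ← comap_map_mkQ_of_le hW, ← comap_inf]
  exact map_comap_eq_of_surjective X.mkQ_surjective _

theorem finrank_map_mkQ_add [FiniteDimensional K V] {X U : Submodule K V} (h : X ≤ U) :
    finrank K (U.map X.mkQ) + finrank K X = finrank K U := by
  have key := (X.mkQ.domRestrict U).finrank_range_add_finrank_ker
  rwa [LinearMap.range_domRestrict, LinearMap.ker_domRestrict, ker_mkQ,
    (comapSubtypeEquivOfLe h).finrank_eq] at key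

end Submodule

/-- Quotienting by a common subspace preserves the subspace distance. -/
theorem sDist_map_mkQ {K V : Type*} [Field K] [AddCommGroup V] [Module K V]
    [FiniteDimensional K V] {X U W : Submodule K V} (hU : X ≤ U) (hW : X ≤ W) :
    sDist (U.map X.mkQ) (W.map X.mkQ) = sDist U W := by
  unfold sDist
  rw [← Submodule.map_sup, ← Submodule.map_mkQ_inf hU hW]
  have hsup := Submodule.finrank_map_mkQ_add (le_sup_of_le_left hU : X ≤ U ⊔ W)
  have hinf := Submodule.finrank_map_mkQ_add (le_inf hU hW)
  omega

/-- Quotienting a constant dimension code by a subspace `X` of dimension `a < k`: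
the codewords containing `X` map to `(k-a)`-dimensional subspaces of `V/X`, the
minimum distance is preserved, and no two codewords are identified. -/
theorem quotient_code (K V : Type*) [Field K] [AddCommGroup V] [Module K V]
    [FiniteDimensional K V] (v k d a : ℕ) (hV : finrank K V = v)
    (C : Set (Submodule K V))
    (hdim : ∀ U ∈ C, finrank K ↥U = k)
    (hdist : ∀ U ∈ C, ∀ W ∈ C, U ≠ W → d ≤ sDist U W)
    (X : Submodule K V) (hX : finrank K ↥X = a) (hak : a < k) :
    (∀ Y ∈ Submodule.map X.mkQ '' {U ∈ C | X ≤ U}, finrank K ↥Y = k - a) ∧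
    (∀ Y ∈ Submodule.map X.mkQ '' {U ∈ C | X ≤ U},
      ∀ Z ∈ Submodule.map X.mkQ '' {U ∈ C | X ≤ U}, Y ≠ Z → d ≤ sDist Y Z) ∧
    (Submodule.map X.mkQ '' {U ∈ C | X ≤ U}).ncard = {U ∈ C | X ≤ U}.ncard := by
  refine ⟨?_, ?_, ?_⟩
  · rintro _ ⟨U, ⟨hUC, hXU⟩, rfl⟩
    have h := Submodule.finrank_map_mkQ_add hXU
    rw [hdim U hUC, hX] at h
    omega
  · rintro _ ⟨U, ⟨hUC, hXU⟩, rfl⟩ _ ⟨W, ⟨hWC, hXW⟩, rfl⟩ hne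
    rw [sDist_map_mkQ hXU hXW]
    exact hdist U hUC W hWC fun h => hne (congrArg _ h)
  · exact Set.InjOn.ncard_image ((Submodule.injOn_map_mkQ X).mono fun _ hU => hU.2)
end

section
/- Let V be a v-dimensional vector space over the finite field F_q, let C be a set of k-dimensional subspaces of V whose pairwise subspace distances are all at least d, let N = |C|, let k ≤ l ≤ v, and let b be a natural number. If #{U ∈ C : U ≤ X} ≤ b for every l-dimensional subspace X of V, then N · G_q(v − k, l − k) ≤ G_q(v, l) · b, where G_q(m, j) denotes the number of j-dimensional subspaces of an m-dimensional vector space over F_q (the Gaussian binomial coefficient [m choose j]_q); here G_q(v − k, l − k) equals the number of l-dimensional subspaces of V containing a fixed k-dimensional subspace. -/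
open Module

/-- The Gaussian binomial coefficient `[m choose j]_q`: the number of `j`-dimensional
subspaces of an `m`-dimensional vector space over the finite field `K` (with `q` elements). -/
noncomputable def gaussNum (K : Type*) [Field K] (m j : ℕ) : ℕ :=
  Nat.card {X : Submodule K (Fin m → K) // Module.finrank K ↥X = j}

/-- `gaussNum` counts the `j`-dimensional subspaces of any space of dimension `m`. -/
theorem natCard_submodule_finrank_eq {K W : Type*} [Field K] [AddCommGroup W] [Module K W]
    [FiniteDimensional K W] {m : ℕ} (hW : finrank K W = m) (j : ℕ) :
    Nat.card {X : Submodule K W // finrank K ↥X = j} = gaussNum K m j := by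
  have e : W ≃ₗ[K] (Fin m → K) := LinearEquiv.ofFinrankEq _ _ (by simp [hW])
  refine Nat.card_congr ((Submodule.orderIsoMapComap e).toEquiv.subtypeEquiv fun X => ?_)
  have h : finrank K ↥(X.map (e : W →ₗ[K] (Fin m → K))) = finrank K ↥X :=
    LinearEquiv.finrank_map_eq e X
  change _ ↔ finrank K ↥(X.map (e : W →ₗ[K] (Fin m → K))) = j
  rw [h]

/-- The preimage in `V` of a subspace of `V ⧸ U` has dimension larger by `dim U`. -/
theorem finrank_comap_mkQ {K V : Type*} [Field K] [AddCommGroup V] [Module K V]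
    [FiniteDimensional K V] (U : Submodule K V) (Y : Submodule K (V ⧸ U)) :
    finrank K ↥(Y.comap U.mkQ) = finrank K ↥Y + finrank K ↥U := by
  have hle : U ≤ Y.comap U.mkQ := Submodule.le_comap_mkQ U Y
  have hmap : (Y.comap U.mkQ).map U.mkQ = Y :=
    Submodule.map_comap_eq_of_surjective U.mkQ_surjective Y
  have h₁ := Submodule.finrank_quotient_add_finrank (Y.comap U.mkQ)
  have h₂ := Submodule.finrank_quotient_add_finrank Y
  have h₃ := Submodule.finrank_quotient_add_finrank U
  have h₄ := (Submodule.quotientQuotientEquivQuotient U _ hle).finrank_eq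
  rw [hmap] at h₄
  omega

/-- The number of `l`-dimensional subspaces of `V` containing a fixed subspace `U`. -/
theorem natCard_submodule_finrank_eq_and_le {K V : Type*} [Field K] [AddCommGroup V]
    [Module K V] [FiniteDimensional K V] (U : Submodule K V) {l : ℕ}
    (hl : finrank K ↥U ≤ l) :
    Nat.card {X : Submodule K V // finrank K ↥X = l ∧ U ≤ X} =
      gaussNum K (finrank K V - finrank K ↥U) (l - finrank K ↥U) := by
  have hQ : finrank K (V ⧸ U) = finrank K V - finrank K ↥U := by
    have := Submodule.finrank_quotient_add_finrank U
    omega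
  rw [← natCard_submodule_finrank_eq hQ]
  have hdim (Y : {Y : Submodule K (V ⧸ U) // finrank K ↥Y = l - finrank K ↥U}) :
      finrank K ↥(Y.1.comap U.mkQ) = l := by
    rw [finrank_comap_mkQ, Y.2]
    omega
  refine (Nat.card_congr (Equiv.ofBijective
    (fun Y => ⟨Y.1.comap U.mkQ, hdim Y, Submodule.le_comap_mkQ U Y.1⟩) ⟨?_, ?_⟩)).symm
  · intro Y Z h
    exact Subtype.ext (Submodule.comap_injective_of_surjective U.mkQ_surjective
      (congrArg Subtype.val h))
  · rintro ⟨X, hX, hUX⟩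
    have hcomap : (X.map U.mkQ).comap U.mkQ = X := by
      rw [Submodule.comap_map_mkQ, sup_eq_right.mpr hUX]
    refine ⟨⟨X.map U.mkQ, ?_⟩, Subtype.ext hcomap⟩
    have := finrank_comap_mkQ U (X.map U.mkQ)
    rw [hcomap] at this
    omega

/-- If every `l`-dimensional subspace (`k ≤ l ≤ v`) contains at most `b` codewords of a
`(v,N,d;k)_q` constant dimension code, then `N · [v-k choose l-k]_q ≤ [v choose l]_q · b`. -/
theorem counting_bound_high (K : Type*) [Field K] [Fintype K]
    (V : Type*) [AddCommGroup V] [Module K V] [FiniteDimensional K V]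
    (v k d l b N : ℕ) (hV : finrank K V = v) (hkl : k ≤ l) (hlv : l ≤ v)
    (C : Set (Submodule K V)) (hN : N = C.ncard)
    (hdim : ∀ U ∈ C, finrank K ↥U = k)
    (hdist : ∀ U ∈ C, ∀ W ∈ C, U ≠ W → d ≤ sDist U W)
    (hb : ∀ X : Submodule K V, finrank K ↥X = l → {U ∈ C | U ≤ X}.ncard ≤ b) :
    N * gaussNum K (v - k) (l - k) ≤ gaussNum K v l * b := by
  classical
  have : Finite V := Module.finite_of_finite K
  have := Fintype.ofFinite (Submodule K V)
  have hC : N = C.toFinset.card := by rw [hN, Set.ncard_eq_toFinset_card']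
  have hL : gaussNum K v l =
      (Finset.univ.filter fun X : Submodule K V => finrank K ↥X = l).card := by
    rw [← natCard_submodule_finrank_eq hV, Nat.card_eq_fintype_card, Fintype.card_subtype]
  rw [hC, hL]
  refine Finset.card_mul_le_card_mul (· ≤ ·) (fun U hU => ?_) (fun X hX => ?_)
  · have hUk := hdim U (Set.mem_toFinset.mp hU)
    have h := natCard_submodule_finrank_eq_and_le U (hUk.trans_le hkl)
    rw [hV, hUk, Nat.card_eq_fintype_card, Fintype.card_subtype] at h
    rw [← h, Finset.bipartiteAbove, Finset.filter_filter]
  · refine le_trans (le_of_eq ?_) (hb X (Finset.mem_filter.mp hX).2)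
    rw [← Set.ncard_coe_finset]
    congr 1
    ext U
    simp
end

section
/- Let k ≥ 1, let q be a prime power, let C be a set of k-dimensional subspaces of V = F_q^{2k} whose pairwise subspace distances are all at least 2k − 2, and let c be a natural number with c ≤ q^k + 1. If #{U ∈ C : U ≤ H} ≤ q^k + 1 − c for every hyperplane H of V (i.e., every (2k−1)-dimensional subspace), then |C| ≤ (q^k + 1)(q^k + 1 − c). -/
open Module

/-- Over a finite field with `q` elements, exactly `q ^ (dim V - dim U) - 1` nonzero functionals
on `V` vanish on the subspace `U`. -/
theorem card_nonzero_dual_vanishing {K V : Type*} [Field K] [Fintype K] [AddCommGroup V]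
    [Module K V] [FiniteDimensional K V] (U : Submodule K V) :
    {f : Dual K V | f ≠ 0 ∧ U ≤ LinearMap.ker f}.ncard =
      Fintype.card K ^ (finrank K V - finrank K U) - 1 := by
  have hset : {f : Dual K V | f ≠ 0 ∧ U ≤ LinearMap.ker f} =
      (U.dualAnnihilator : Set (Dual K V)) \ {0} := by
    ext f
    simp only [Set.mem_ofPred_eq, Set.mem_sdiff, SetLike.mem_coe, Submodule.mem_dualAnnihilator,
      Set.mem_singleton_iff, SetLike.le_def, LinearMap.mem_ker]
    tauto
  have hrank : finrank K U.dualAnnihilator = finrank K V - finrank K U := by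
    have := Subspace.finrank_add_finrank_dualAnnihilator_eq U
    omega
  rw [hset, Set.ncard_sdiff_singleton_of_mem (zero_mem U.dualAnnihilator), ← hrank,
    ← Nat.card_eq_fintype_card, ← Module.natCard_eq_pow_finrank (K := K) (V := U.dualAnnihilator)]
  rfl

/-- If every hyperplane of `F_q^{2k}` contains at most `q^k + 1 - c` codewords of a
`(2k,N,2k-2;k)_q` constant dimension code `C`, then `|C| ≤ (q^k+1)(q^k+1-c)`. -/
theorem hyperplane_bound (K : Type*) [Field K] [Fintype K] (q k c : ℕ)
    (hq : Fintype.card K = q) (hk : 1 ≤ k) (hc : c ≤ q ^ k + 1)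
    (C : Set (Submodule K (Fin (2 * k) → K)))
    (hdim : ∀ U ∈ C, finrank K ↥U = k)
    (hdist : ∀ U ∈ C, ∀ W ∈ C, U ≠ W → 2 * k - 2 ≤ sDist U W)
    (hb : ∀ H : Submodule K (Fin (2 * k) → K), finrank K ↥H = 2 * k - 1 →
      {U ∈ C | U ≤ H}.ncard ≤ q ^ k + 1 - c) :
    C.ncard ≤ (q ^ k + 1) * (q ^ k + 1 - c) := by
  classical
  let V := Fin (2 * k) → K
  have : Finite (Dual K V) := Module.finite_of_finite K
  have : Fintype (Dual K V) := Fintype.ofFinite _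
  have hV : finrank K V = 2 * k := by simp [V]
  have hCfin : C.Finite := Set.toFinite C
  let s : Finset (Submodule K V) := hCfin.toFinset
  let t : Finset (Dual K V) := {f | f ≠ 0}
  have ht : t.card = (q ^ k) ^ 2 - 1 := by
    have h := card_nonzero_dual_vanishing (⊥ : Submodule K V)
    rw [finrank_bot, hV, hq, Nat.sub_zero] at h
    rw [← pow_mul, mul_comm k 2, ← h, ← Set.ncard_coe_finset]
    congr 1
    ext f
    simp [t]
  have hcount : s.card * (q ^ k - 1) ≤ t.card * (q ^ k + 1 - c) := by
    refine Finset.card_mul_le_card_mul (fun U f ↦ U ≤ LinearMap.ker f) (fun U hU ↦ ?_)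
      (fun f hf ↦ ?_)
    · have h := card_nonzero_dual_vanishing U
      rw [hdim U (hCfin.mem_toFinset.mp hU), hV, hq, show 2 * k - k = k by omega] at h
      rw [← h, ← Set.ncard_coe_finset]
      apply le_of_eq
      congr 1
      ext f
      simp [t, Finset.bipartiteAbove]
    · have hf0 : f ≠ 0 := by simpa [t] using hf
      have hker : finrank K (LinearMap.ker f) = 2 * k - 1 := by
        have := Module.Dual.finrank_ker_add_one_of_ne_zero hf0
        omega
      convert hb _ hker
      rw [← Set.ncard_coe_finset]
      congr 1
      ext U
      simp only [s, Finset.bipartiteBelow, Finset.coe_filter, Set.Finite.mem_toFinset]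
      exact Iff.rfl
  have hqk : 1 < q ^ k := Nat.one_lt_pow (by omega) (hq ▸ Fintype.one_lt_card)
  rw [Set.ncard_eq_toFinset_card C hCfin]
  refine Nat.le_of_mul_le_mul_right (c := q ^ k - 1) ?_ (by omega)
  calc s.card * (q ^ k - 1) ≤ ((q ^ k) ^ 2 - 1) * (q ^ k + 1 - c) := ht ▸ hcount
    _ = (q ^ k + 1) * (q ^ k + 1 - c) * (q ^ k - 1) := by
      rw [← one_pow 2, Nat.sq_sub_sq, one_pow]
      ring
end

section
/- Let k ≥ 1, let q be a prime power, let C be a set of k-dimensional subspaces of V = F_q^{2k} whose pairwise subspace distances are all at least 2k − 2, and let c be a natural number with c ≤ q^k + 1. If #{U ∈ C : P ≤ U} ≤ q^k + 1 − c for every point P of V (i.e., every 1-dimensional subspace), then |C| ≤ (q^k + 1)(q^k + 1 − c). -/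
open Module

/-- If every point of `F_q^{2k}` is contained in at most `q^k + 1 - c` codewords of a
`(2k,N,2k-2;k)_q` constant dimension code `C`, then `|C| ≤ (q^k+1)(q^k+1-c)`. -/
theorem point_bound (K : Type*) [Field K] [Fintype K] (q k c : ℕ)
    (hq : Fintype.card K = q) (hk : 1 ≤ k) (hc : c ≤ q ^ k + 1)
    (C : Set (Submodule K (Fin (2 * k) → K)))
    (hdim : ∀ U ∈ C, finrank K ↥U = k)
    (hdist : ∀ U ∈ C, ∀ W ∈ C, U ≠ W → 2 * k - 2 ≤ sDist U W)
    (hb : ∀ P : Submodule K (Fin (2 * k) → K), finrank K ↥P = 1 →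
      {U ∈ C | P ≤ U}.ncard ≤ q ^ k + 1 - c) :
    C.ncard ≤ (q ^ k + 1) * (q ^ k + 1 - c) := by
  classical
  have hq1 : 1 < q := hq ▸ Fintype.one_lt_card
  have hpow : 1 < q ^ k := Nat.one_lt_pow (by omega) hq1
  have hcount := Finset.card_mul_le_card_mul
    (s := C.toFinite.toFinset) (t := Finset.univ.erase (0 : Fin (2 * k) → K))
    (m := q ^ k - 1) (n := q ^ k + 1 - c) (fun U v => v ∈ U)
    (fun U hU => by
      have hcard : Fintype.card U = q ^ k := by
        rw [Module.card_eq_pow_finrank (K := K), hq, hdim U (by simpa using hU)]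
      rw [Finset.bipartiteAbove, Finset.filter_erase, Finset.card_erase_of_mem (by simp),
        ← hcard, Fintype.card_subtype])
    (fun v hv => by
      have hv0 : v ≠ 0 := by simpa using hv
      refine le_trans (le_of_eq ?_) (hb (K ∙ v) (finrank_span_singleton hv0))
      rw [← Set.ncard_coe_finset]
      congr 1
      ext U
      simp [Finset.bipartiteBelow])
  rw [Finset.card_erase_of_mem (Finset.mem_univ _), Finset.card_univ, Fintype.card_fun, hq,
    Fintype.card_fin, ← Set.ncard_eq_toFinset_card] at hcount
  have hfactor : q ^ (2 * k) - 1 = (q ^ k + 1) * (q ^ k - 1) := by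
    rw [mul_comm 2 k, pow_mul, ← Nat.sq_sub_sq, one_pow]
  rw [hfactor] at hcount
  refine Nat.le_of_mul_le_mul_right (c := q ^ k - 1) ?_ (by omega)
  calc C.ncard * (q ^ k - 1) ≤ (q ^ k + 1) * (q ^ k - 1) * (q ^ k + 1 - c) := hcount
    _ = (q ^ k + 1) * (q ^ k + 1 - c) * (q ^ k - 1) := by ring
end

section
/- Let V be a v-dimensional vector space over the finite field F_q, let C be a set of subspaces of V whose pairwise subspace distances are all at least d with d ≥ 2, let P be a 1-dimensional subspace and H a (v−1)-dimensional subspace of V with P not contained in H. Then the shortened code S(C,P,H) = { U ∩ H : U ∈ C, P ≤ U } ∪ { U ∈ C : U ≤ H } is a set of subspaces of H whose pairwise subspace distances are all at least d − 1, and |S(C,P,H)| = #{U ∈ C : P ≤ U} + #{U ∈ C : U ≤ H}. Moreover, if every member of C has dimension in a set K, then every member of S(C,P,H) has dimension in K ∪ {k−1 : k ∈ K}. -/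
open Module

/-- The shortened code `S(C,P,H) = {U ∩ H : U ∈ C, P ≤ U} ∪ {U ∈ C : U ≤ H}`. -/
def shortenedCode {K V : Type*} [Field K] [AddCommGroup V] [Module K V]
    (C : Set (Submodule K V)) (P H : Submodule K V) : Set (Submodule K V) :=
  ((fun U => U ⊓ H) '' {U ∈ C | P ≤ U}) ∪ {U ∈ C | U ≤ H}

section Shortening

variable {K V : Type*} [Field K] [AddCommGroup V] [Module K V]

theorem sDist_comm (U W : Submodule K V) : sDist U W = sDist W U := by
  rw [sDist, sDist, sup_comm, inf_comm]

theorem sDist_self (U : Submodule K V) : sDist U U = 0 := by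
  rw [sDist, sup_idem, inf_idem, Nat.sub_self]

variable [FiniteDimensional K V]

theorem sDist_add_two_mul_finrank_inf (U W : Submodule K V) :
    sDist U W + 2 * finrank K ↥(U ⊓ W) = finrank K ↥U + finrank K ↥W := by
  have h := Submodule.finrank_sup_add_finrank_inf_eq U W
  have hle : finrank K ↥(U ⊓ W) ≤ finrank K ↥(U ⊔ W) :=
    Submodule.finrank_mono (inf_le_left.trans le_sup_left)
  unfold sDist
  omega

/-- A hyperplane cuts down by one the dimension of every subspace it does not contain. -/
theorem finrank_inf_hyperplane_add_one {H U : Submodule K V}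
    (hH : finrank K ↥H = finrank K V - 1) (hU : ¬ U ≤ H) :
    finrank K ↥(U ⊓ H) + 1 = finrank K ↥U := by
  have hlt : finrank K ↥H < finrank K ↥(U ⊔ H) :=
    Submodule.finrank_lt_finrank_of_lt (right_lt_sup.2 hU)
  have hle : finrank K ↥(U ⊔ H) ≤ finrank K V := Submodule.finrank_le _
  have h := Submodule.finrank_sup_add_finrank_inf_eq U H
  omega

theorem sDist_inf_hyperplane_inf_hyperplane {P H U W : Submodule K V}
    (hH : finrank K ↥H = finrank K V - 1) (hPH : ¬ P ≤ H) (hU : P ≤ U) (hW : P ≤ W) :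
    sDist (U ⊓ H) (W ⊓ H) = sDist U W := by
  have hUH := finrank_inf_hyperplane_add_one hH fun h => hPH (hU.trans h)
  have hWH := finrank_inf_hyperplane_add_one hH fun h => hPH (hW.trans h)
  have hUWH := finrank_inf_hyperplane_add_one (U := U ⊓ W) hH
    fun h => hPH ((le_inf hU hW).trans h)
  have h₁ := sDist_add_two_mul_finrank_inf U W
  have h₂ := sDist_add_two_mul_finrank_inf (U ⊓ H) (W ⊓ H)
  rw [← inf_inf_distrib_right] at h₂
  omega

theorem sDist_inf_hyperplane_add_one {H U W : Submodule K V}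
    (hH : finrank K ↥H = finrank K V - 1) (hU : ¬ U ≤ H) (hW : W ≤ H) :
    sDist (U ⊓ H) W + 1 = sDist U W := by
  have hUH := finrank_inf_hyperplane_add_one hH hU
  have h₁ := sDist_add_two_mul_finrank_inf U W
  have h₂ := sDist_add_two_mul_finrank_inf (U ⊓ H) W
  rw [inf_assoc, inf_eq_right.2 hW] at h₂
  omega

end Shortening

/-- The shortened code of a `(v,N,d;K)_q` subspace code (`d ≥ 2`) with respect to a point `P`
and a hyperplane `H` with `P ⊄ H` consists of subspaces of `H`, has minimum subspace distance
at least `d - 1`, has cardinality `#{U ∈ C : P ≤ U} + #{U ∈ C : U ≤ H}`, and its dimensions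
lie in `K ∪ {k - 1 : k ∈ K}`. -/
theorem shortenedCode_spec (K V : Type*) [Field K] [Fintype K] [AddCommGroup V] [Module K V]
    [FiniteDimensional K V] (v d : ℕ) (hV : finrank K V = v) (hd : 2 ≤ d)
    (C : Set (Submodule K V))
    (hdist : ∀ U ∈ C, ∀ W ∈ C, U ≠ W → d ≤ sDist U W)
    (P H : Submodule K V) (hP : finrank K ↥P = 1) (hH : finrank K ↥H = v - 1)
    (hPH : ¬ P ≤ H) :
    (∀ W ∈ shortenedCode C P H, W ≤ H) ∧
    (∀ U ∈ shortenedCode C P H, ∀ W ∈ shortenedCode C P H, U ≠ W → d - 1 ≤ sDist U W) ∧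
    (shortenedCode C P H).ncard = {U ∈ C | P ≤ U}.ncard + {U ∈ C | U ≤ H}.ncard ∧
    (∀ D : Set ℕ, (∀ U ∈ C, finrank K ↥U ∈ D) →
      ∀ W ∈ shortenedCode C P H, finrank K ↥W ∈ D ∪ (fun k => k - 1) '' D) := by
  subst hV
  have hne : ∀ {U}, P ≤ U → ¬ U ≤ H := fun hU h => hPH (hU.trans h)
  have hmixed : ∀ U ∈ C, P ≤ U → ∀ W ∈ C, W ≤ H → d ≤ sDist (U ⊓ H) W + 1 := by
    intro U hUC hPU W hWC hWH
    rw [sDist_inf_hyperplane_add_one hH (hne hPU) hWH]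
    exact hdist U hUC W hWC fun h => hne hPU (h ▸ hWH)
  have hinj : Set.InjOn (fun U => U ⊓ H) {U ∈ C | P ≤ U} := by
    rintro U ⟨hUC, hPU⟩ W ⟨hWC, hPW⟩ (hUW : U ⊓ H = W ⊓ H)
    by_contra hUW'
    have h := hdist U hUC W hWC hUW'
    rw [← sDist_inf_hyperplane_inf_hyperplane hH hPH hPU hPW, hUW, sDist_self] at h
    omega
  have hdisj : Disjoint ((fun U => U ⊓ H) '' {U ∈ C | P ≤ U}) {U ∈ C | U ≤ H} := by
    rw [Set.disjoint_left]
    rintro _ ⟨U, ⟨hUC, hPU⟩, rfl⟩ ⟨hWC, hWH⟩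
    have h := hmixed U hUC hPU _ hWC hWH
    rw [sDist_self] at h
    omega
  refine ⟨?_, ?_, ?_, ?_⟩
  · rintro _ (⟨U, -, rfl⟩ | ⟨-, hWH⟩)
    exacts [inf_le_right, hWH]
  · rintro _ (⟨U, ⟨hUC, hPU⟩, rfl⟩ | ⟨hUC, hUH⟩) _ (⟨W, ⟨hWC, hPW⟩, rfl⟩ | ⟨hWC, hWH⟩) hUW
    · have h := hdist U hUC W hWC fun h => hUW (h ▸ rfl)
      rw [← sDist_inf_hyperplane_inf_hyperplane hH hPH hPU hPW] at h
      exact (Nat.sub_le _ _).trans h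
    · exact Nat.sub_le_of_le_add (hmixed U hUC hPU _ hWC hWH)
    · rw [sDist_comm]
      exact Nat.sub_le_of_le_add (hmixed W hWC hPW _ hUC hUH)
    · exact (Nat.sub_le _ _).trans (hdist _ hUC _ hWC hUW)
  · have : Finite V := Module.finite_of_finite K
    rw [shortenedCode, Set.ncard_union_eq hdisj (Set.toFinite _) (Set.toFinite _),
      hinj.ncard_image]
  · rintro D hD _ (⟨U, ⟨hUC, hPU⟩, rfl⟩ | ⟨hWC, -⟩)
    · exact Or.inr ⟨_, hD U hUC,
        (Nat.eq_sub_of_add_eq (finrank_inf_hyperplane_add_one hH (hne hPU))).symm⟩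
    · exact Or.inl (hD _ hWC)
end

section
/- Let 1 ≤ k ≤ v − 1, let q be a prime power, let S be a set of k-dimensional subspaces of V = F_q^v, and let b ≥ 1 be a natural number. If |S| · (q^{v−k} + q^k − 2) > (q^v − 1)(b − 1), then there exist a hyperplane H̄ (a (v−1)-dimensional subspace of V) and a point P̄ (a 1-dimensional subspace of V) with P̄ not contained in H̄ such that #{U ∈ S : U ≤ H̄} + #{U ∈ S : P̄ ≤ U} ≥ b. -/
open Module

section Averaging

open Finset

variable {K W : Type*} [Field K] [Fintype K] [AddCommGroup W] [Module K W]
  [Fintype W]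

open scoped Classical in
/-- A nonzero functional takes the value `1` at exactly `q ^ (dim W - 1)` vectors. -/
theorem card_filter_dual_apply_eq_one (g : Dual K W) (hg : g ≠ 0) :
    #{w | g w = 1} = Fintype.card K ^ (finrank K W - 1) := by
  obtain ⟨w₀, hw₀⟩ := LinearMap.surjective_of_ne_zero hg 1
  have hker := Module.Dual.finrank_ker_add_one_of_ne_zero hg
  have hcard := Module.card_eq_pow_finrank (K := K) (V := LinearMap.ker g)
  rw [show finrank K W - 1 = finrank K (LinearMap.ker g) by omega, ← hcard,
    ← Fintype.card_subtype]
  refine Fintype.card_congr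
    { toFun := fun w => ⟨w.1 - w₀, by simp [w.2, hw₀]⟩
      invFun := fun w => ⟨w.1 + w₀, by simp [hw₀, LinearMap.mem_ker.1 w.2]⟩
      left_inv := fun w => by simp
      right_inv := fun w => by simp }

open scoped Classical in
theorem sum_ite_dual_apply_eq_one [Fintype (Dual K W)] (F : Dual K W → ℕ) :
    ∑ f : Dual K W, ∑ w : W, (if f w = 1 then F f else 0) =
      Fintype.card K ^ (finrank K W - 1) * ∑ f with f ≠ 0, F f := by
  rw [mul_sum, sum_filter]
  refine sum_congr rfl fun f _ => ?_
  rw [← sum_filter, sum_const, smul_eq_mul]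
  split_ifs with hf
  · rw [card_filter_dual_apply_eq_one f hf]
  · simp [not_not.1 hf]

open scoped Classical in
theorem sum_ite_apply_dual_eq_one [Fintype (Dual K W)] (F : W → ℕ) :
    ∑ f : Dual K W, ∑ w : W, (if f w = 1 then F w else 0) =
      Fintype.card K ^ (finrank K W - 1) * ∑ w with w ≠ 0, F w := by
  rw [sum_comm, mul_sum, sum_filter]
  refine sum_congr rfl fun w _ => ?_
  rw [← sum_filter, sum_const, smul_eq_mul]
  split_ifs with hw
  · have h := card_filter_dual_apply_eq_one (Dual.eval K W w)
      (by rwa [Ne, Module.eval_apply_eq_zero_iff])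
    rw [Subspace.dual_finrank_eq] at h
    rw [← h]
    rfl
  · simp [not_not.1 hw]

open scoped Classical in
theorem card_filter_ne_zero_and_mem (U : Submodule K W) :
    #{w | w ≠ 0 ∧ w ∈ U} = Fintype.card K ^ finrank K U - 1 := by
  have hcard := Module.card_eq_pow_finrank (K := K) (V := U)
  have h : ({w | w ≠ 0 ∧ w ∈ U} : Finset W) = ({w | w ∈ U} : Finset W).erase 0 := by
    ext w; simp
  rw [h, card_erase_of_mem (by simp), ← hcard, ← Fintype.card_subtype]

open scoped Classical in
/-- Double counting incidences between nonzero vectors and the members of a family of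
`k`-dimensional subspaces. -/
theorem sum_card_filter_mem {ι : Type*} (T : Finset ι) (U : ι → Submodule K W) (k : ℕ)
    (hU : ∀ i ∈ T, finrank K (U i) = k) :
    ∑ w : W with w ≠ 0, #{i ∈ T | w ∈ U i} = #T * (Fintype.card K ^ k - 1) := by
  simp_rw [card_filter]
  rw [sum_comm, ← smul_eq_mul, ← sum_const]
  refine sum_congr rfl fun i hi => ?_
  rw [← hU i hi, ← card_filter_ne_zero_and_mem, ← card_filter, filter_filter]

open scoped Classical in
/-- If `f x = 1` forces `f` and `x` to be incident with at most `c` members of `T`, then `T`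
is small. -/
theorem card_mul_le_of_forall_dual_apply_eq_one (T : Finset (Submodule K W)) (k c : ℕ)
    (hT : ∀ U ∈ T, finrank K U = k)
    (h : ∀ (f : Dual K W) (x : W), f x = 1 →
      #{U ∈ T | U ≤ LinearMap.ker f} + #{U ∈ T | x ∈ U} ≤ c) :
    #T * ((Fintype.card K ^ (finrank K W - k) - 1) + (Fintype.card K ^ k - 1)) ≤
      (Fintype.card K ^ finrank K W - 1) * c := by
  have : Finite (Dual K W) := Module.finite_of_finite K
  let _ : Fintype (Dual K W) := Fintype.ofFinite _
  have hsum : ∑ f : Dual K W, ∑ x : W, (if f x = 1 then #{U ∈ T | U ≤ LinearMap.ker f} else 0)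
      + ∑ f : Dual K W, ∑ x : W, (if f x = 1 then #{U ∈ T | x ∈ U} else 0)
      ≤ ∑ f : Dual K W, ∑ x : W, (if f x = 1 then c else 0) := by
    simp_rw [← sum_add_distrib]
    refine sum_le_sum fun f _ => sum_le_sum fun x _ => ?_
    split_ifs with hfx
    · exact h f x hfx
    · simp
  have hker : ∀ (f : Dual K W) (U : Submodule K W),
      U ≤ LinearMap.ker f ↔ f ∈ U.dualAnnihilator := fun f U => by
    simp [SetLike.le_def, Submodule.mem_dualAnnihilator]
  have hann : ∀ U ∈ T, finrank K U.dualAnnihilator = finrank K W - k := fun U hU => by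
    have := Subspace.finrank_add_finrank_dualAnnihilator_eq U
    have := hT U hU
    omega
  have htop : #{x : W | x ≠ 0} = Fintype.card K ^ finrank K W - 1 := by
    have := card_filter_ne_zero_and_mem (⊤ : Submodule K W)
    simpa using this
  have hhyp : ∑ f : Dual K W with f ≠ 0, #{U ∈ T | U ≤ LinearMap.ker f} =
      #T * (Fintype.card K ^ (finrank K W - k) - 1) := by
    rw [← sum_card_filter_mem T _ _ hann]
    exact sum_congr (by ext; simp) fun f _ => congrArg card (filter_congr fun U _ => hker f U)
  rw [sum_ite_dual_apply_eq_one, sum_ite_apply_dual_eq_one,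
    sum_ite_apply_dual_eq_one (fun _ => c), hhyp,
    sum_card_filter_mem T _ _ hT, sum_const, smul_eq_mul, htop, ← mul_add, ← mul_add] at hsum
  exact Nat.le_of_mul_le_mul_left hsum (pow_pos Fintype.card_pos _)

end Averaging

/-- If `S` is a large enough set of `k`-dimensional subspaces of `F_q^v`, then there is a
point–hyperplane pair `(P̄, H̄)` with `P̄ ⊄ H̄` incident with at least `b` members of `S`. -/
theorem exists_point_hyperplane (K : Type*) [Field K] [Fintype K] (q v k b : ℕ)
    (hq : Fintype.card K = q) (hk1 : 1 ≤ k) (hkv : k ≤ v - 1) (hb : 1 ≤ b)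
    (S : Set (Submodule K (Fin v → K)))
    (hdim : ∀ U ∈ S, finrank K ↥U = k)
    (hcard : S.ncard * (q ^ (v - k) + q ^ k - 2) > (q ^ v - 1) * (b - 1)) :
    ∃ H P : Submodule K (Fin v → K), finrank K ↥H = v - 1 ∧ finrank K ↥P = 1 ∧
      ¬ P ≤ H ∧ b ≤ {U ∈ S | U ≤ H}.ncard + {U ∈ S | P ≤ U}.ncard := by
  classical
  subst hq
  by_contra! hcon
  lift S to Finset (Submodule K (Fin v → K)) using Set.toFinite S
  have hle := card_mul_le_of_forall_dual_apply_eq_one S k (b - 1) hdim fun f x hfx => by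
    have hf : f ≠ 0 := by rintro rfl; simp at hfx
    have hx : x ≠ 0 := by rintro rfl; simp at hfx
    have hker := Module.Dual.finrank_ker_add_one_of_ne_zero hf
    rw [finrank_fin_fun] at hker
    have hlt := hcon (LinearMap.ker f) (K ∙ x) (by omega) (finrank_span_singleton hx)
      (by simp [Submodule.span_singleton_le_iff_mem, hfx])
    simp only [Submodule.span_singleton_le_iff_mem, Finset.mem_coe, ← Finset.coe_filter,
      Set.ncard_coe_finset] at hlt
    omega
  have h₁ : 1 ≤ Fintype.card K ^ (v - k) := Nat.one_le_pow _ _ Fintype.card_pos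
  have h₂ : 1 ≤ Fintype.card K ^ k := Nat.one_le_pow _ _ Fintype.card_pos
  rw [finrank_fin_fun, show Fintype.card K ^ (v - k) - 1 + (Fintype.card K ^ k - 1) =
    Fintype.card K ^ (v - k) + Fintype.card K ^ k - 2 by omega] at hle
  rw [Set.ncard_coe_finset] at hcard
  omega
end

section
/- Let k ≥ 3, let q be a prime power, and let C be a set of k-dimensional subspaces of V = F_q^{2k} whose pairwise subspace distances are all at least 2k − 2. Then for every 1-dimensional subspace P of V we have #{U ∈ C : P ≤ U} ≤ q^k + 1. -/
open Module

section PartialSpread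

variable {K V : Type*} [Field K] [AddCommGroup V] [Module K V] [FiniteDimensional K V]

/-- Two subspaces at distance at least `2k - 2` meet exactly in any point they share. -/
lemma inf_eq_of_le_sDist {k : ℕ} (hk : 2 ≤ k) {U W P : Submodule K V}
    (hU : finrank K U = k) (hW : finrank K W = k) (hd : 2 * k - 2 ≤ sDist U W)
    (hP : finrank K P = 1) (hPU : P ≤ U) (hPW : P ≤ W) : U ⊓ W = P := by
  have h := Submodule.finrank_sup_add_finrank_inf_eq U W
  unfold sDist at hd
  have hinf : finrank K ↥(U ⊓ W) ≤ finrank K P := by omega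
  exact (Submodule.eq_of_le_of_finrank_le (le_inf hPU hPW) hinf).symm

/-- A subspace loses at most one dimension when intersected with a hyperplane. -/
lemma finrank_le_finrank_inf_ker_add_one (f : Dual K V) (U : Submodule K V) :
    finrank K U ≤ finrank K ↥(U ⊓ LinearMap.ker f) + 1 := by
  have h := LinearMap.finrank_range_add_finrank_ker (f.domRestrict U)
  have hr : finrank K (LinearMap.range (f.domRestrict U)) ≤ 1 :=
    (Submodule.finrank_le _).trans (finrank_self K).le
  have hker : finrank K (LinearMap.ker (f.domRestrict U)) =
      finrank K ↥(U ⊓ LinearMap.ker f) := by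
    rw [LinearMap.ker_domRestrict, ← Submodule.finrank_map_subtype_eq,
      Submodule.map_comap_subtype]
  omega

variable [Fintype K]

open Classical in
/-- Subspaces pairwise meeting in `P` occupy disjoint parts of a hyperplane containing `P`. -/
lemma sum_card_inf_ker_le (S : Finset (Submodule K V)) (P : Submodule K V)
    (hPS : ∀ U ∈ S, P ≤ U) (hS : ∀ U ∈ S, ∀ W ∈ S, U ≠ W → U ⊓ W = P)
    (f : Dual K V) (hPf : P ≤ LinearMap.ker f) :
    ∑ U ∈ S, Nat.card ↥(U ⊓ LinearMap.ker f) + Nat.card P ≤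
      Nat.card (LinearMap.ker f) + S.card * Nat.card P := by
  have : Finite V := Module.finite_of_finite K
  have : Fintype V := Fintype.ofFinite V
  let pts : Submodule K V → Finset V := fun U => Finset.univ.filter (· ∈ U)
  have hpts : ∀ U : Submodule K V, (pts U).card = Nat.card U := fun U => by
    rw [Nat.card_eq_fintype_card, Fintype.card_subtype]
  have hdisj : (S : Set (Submodule K V)).PairwiseDisjoint
      (fun U => pts (U ⊓ LinearMap.ker f) \ pts P) := by
    intro U hU W hW hUW
    refine Finset.disjoint_left.mpr fun x hx hy => ?_
    simp only [pts, Finset.mem_sdiff, Finset.mem_filter, Finset.mem_univ, true_and,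
      Submodule.mem_inf] at hx hy
    exact hx.2 (hS U hU W hW hUW ▸ ⟨hx.1.1, hy.1.1⟩)
  have hcard : ∀ U ∈ S, (pts (U ⊓ LinearMap.ker f) \ pts P).card + Nat.card P =
      Nat.card ↥(U ⊓ LinearMap.ker f) := fun U hU => by
    rw [← hpts, ← hpts]
    refine Finset.card_sdiff_add_card_eq_card fun x hx => ?_
    simp only [pts, Finset.mem_filter, Finset.mem_univ, true_and] at hx ⊢
    exact ⟨hPS U hU hx, hPf hx⟩
  have hle : (S.biUnion fun U => pts (U ⊓ LinearMap.ker f) \ pts P).card ≤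
      (pts (LinearMap.ker f) \ pts P).card := by
    refine Finset.card_le_card fun x hx => ?_
    simp only [pts, Finset.mem_biUnion, Finset.mem_sdiff, Finset.mem_filter, Finset.mem_univ,
      true_and, Submodule.mem_inf] at hx ⊢
    obtain ⟨U, -, hx⟩ := hx
    exact ⟨hx.1.2, hx.2⟩
  rw [Finset.card_biUnion hdisj] at hle
  have hker : (pts (LinearMap.ker f) \ pts P).card + Nat.card P =
      Nat.card (LinearMap.ker f) := by
    rw [← hpts, ← hpts]
    refine Finset.card_sdiff_add_card_eq_card fun x hx => ?_
    simp only [pts, Finset.mem_filter, Finset.mem_univ, true_and] at hx ⊢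
    exact hPf hx
  rw [← Finset.sum_congr rfl hcard, Finset.sum_add_distrib, Finset.sum_const, smul_eq_mul]
  omega

open Classical in
/-- More than `q ^ k + 1` subspaces of dimension `k` pairwise meeting in the point `P` leave room
for at most `q` of them in any given hyperplane through `P`. -/
lemma card_filter_le_ker_le {k : ℕ} (hk : 3 ≤ k) (hV : finrank K V = 2 * k)
    (S : Finset (Submodule K V)) (P : Submodule K V) (hP : finrank K P = 1)
    (hdim : ∀ U ∈ S, finrank K U = k)
    (hPS : ∀ U ∈ S, P ≤ U) (hS : ∀ U ∈ S, ∀ W ∈ S, U ≠ W → U ⊓ W = P)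
    (hcard : Fintype.card K ^ k + 2 ≤ S.card)
    (f : Dual K V) (hf : f ≠ 0) (hPf : P ≤ LinearMap.ker f) :
    (S.filter (· ≤ LinearMap.ker f)).card ≤ Fintype.card K := by
  have h := sum_card_inf_ker_le S P hPS hS f hPf
  have hker : finrank K (LinearMap.ker f) = 2 * k - 1 := by
    have := Module.Dual.finrank_ker_add_one_of_ne_zero hf
    omega
  have hq : 2 ≤ Fintype.card K := Fintype.one_lt_card
  have hpow : ∀ U : Submodule K V, Nat.card U = Fintype.card K ^ finrank K U := fun U => by
    rw [Module.natCard_eq_pow_finrank (K := K), Nat.card_eq_fintype_card]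
  simp only [hpow, hP, hker, pow_one] at h
  clear hpow
  generalize Fintype.card K = q at *
  obtain ⟨m, rfl⟩ : ∃ m, k = m + 3 := ⟨k - 3, by omega⟩
  have hlow : ∀ U ∈ S, q ^ (m + 2) + (if U ≤ LinearMap.ker f then q ^ (m + 3) - q ^ (m + 2) else 0)
      ≤ q ^ finrank K ↥(U ⊓ LinearMap.ker f) := by
    intro U hU
    split_ifs with hUf
    · rw [inf_eq_left.mpr hUf, hdim U hU]
      have : q ^ (m + 2) ≤ q ^ (m + 3) := Nat.pow_le_pow_right (by omega) (by omega)
      omega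
    · have := finrank_le_finrank_inf_ker_add_one f U
      rw [hdim U hU] at this
      exact Nat.pow_le_pow_right (by omega) (by omega)
  have hsum := Finset.sum_le_sum hlow
  rw [Finset.sum_add_distrib, Finset.sum_const, smul_eq_mul, ← Finset.sum_filter,
    Finset.sum_const, smul_eq_mul] at hsum
  generalize (S.filter (· ≤ LinearMap.ker f)).card = a at *
  generalize S.card = N at *
  by_contra! ha
  have hsub : q ^ (m + 3) - q ^ (m + 2) = q ^ (m + 2) * (q - 1) := by
    rw [Nat.mul_sub_one, ← pow_succ]
  have key : N * q ^ (m + 2) + a * (q ^ (m + 2) * (q - 1)) + q ≤ q ^ (2 * (m + 3) - 1) + N * q := by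
    rw [← hsub]; omega
  have he : q ^ (2 * (m + 3) - 1) = q ^ (m + 2) * (q ^ (m + 2) * q) := by
    rw [← pow_succ, ← pow_add]; congr 1; omega
  have hy : q * q ≤ q ^ (m + 2) := by
    rw [pow_add, pow_two]; exact Nat.le_mul_of_pos_left _ (Nat.pow_pos (by omega))
  rw [he] at key
  rw [pow_succ] at hcard
  generalize q ^ (m + 2) = y at *
  obtain ⟨r, rfl⟩ : ∃ r, q = r + 2 := ⟨q - 2, by omega⟩
  obtain ⟨b, rfl⟩ : ∃ b, a = r + 2 + 1 + b := ⟨a - (r + 3), by omega⟩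
  obtain ⟨c, rfl⟩ : ∃ c, N = y * (r + 2) + 2 + c := ⟨N - (y * (r + 2) + 2), by omega⟩
  obtain ⟨d, rfl⟩ : ∃ d, y = (r + 2) * (r + 2) + d := ⟨y - (r + 2) * (r + 2), by omega⟩
  rw [show r + 2 - 1 = r + 1 by omega] at key
  ring_nf at key
  omega

open Classical in
/-- Double counting of the pairs of a member of `S` and a nonzero functional vanishing on it. -/
lemma card_mul_le_of_card_filter_le_ker_le {k : ℕ} (hV : finrank K V = 2 * k)
    (S : Finset (Submodule K V)) (P : Submodule K V) (hP : finrank K P = 1)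
    (hdim : ∀ U ∈ S, finrank K U = k) (hPS : ∀ U ∈ S, P ≤ U) (a : ℕ)
    (ha : ∀ f : Dual K V, f ≠ 0 → P ≤ LinearMap.ker f →
      (S.filter (· ≤ LinearMap.ker f)).card ≤ a) :
    S.card * (Fintype.card K ^ k - 1) ≤ a * (Fintype.card K ^ (2 * k - 1) - 1) := by
  have : Finite (Dual K V) := Module.finite_of_finite K
  have : Fintype (Dual K V) := Fintype.ofFinite _
  have hann : ∀ U : Submodule K V,
      (Finset.univ.filter fun f : Dual K V => f ≠ 0 ∧ U ≤ LinearMap.ker f).card =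
        Fintype.card K ^ (2 * k - finrank K U) - 1 := by
    intro U
    have h1 : (Finset.univ.filter fun f : Dual K V => f ≠ 0 ∧ U ≤ LinearMap.ker f) =
        (Finset.univ.filter (· ∈ U.dualAnnihilator)).erase 0 := by
      ext f
      simp [Submodule.mem_dualAnnihilator, SetLike.le_def]
    have h2 := Subspace.finrank_add_finrank_dualAnnihilator_eq U
    rw [h1, Finset.card_erase_of_mem (by simp), ← Fintype.card_subtype,
      ← Nat.card_eq_fintype_card, ← Nat.card_eq_fintype_card,
      Module.natCard_eq_pow_finrank (K := K)]
    congr 2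
    omega
  have hcount := Finset.sum_card_bipartiteAbove_eq_sum_card_bipartiteBelow (s := S)
    (t := Finset.univ.filter fun f : Dual K V => f ≠ 0 ∧ P ≤ LinearMap.ker f)
    (fun U f => U ≤ LinearMap.ker f)
  have hleft : ∀ U ∈ S, (Finset.bipartiteAbove (fun U f => U ≤ LinearMap.ker f)
      (Finset.univ.filter fun f : Dual K V => f ≠ 0 ∧ P ≤ LinearMap.ker f) U).card =
        Fintype.card K ^ k - 1 := by
    intro U hU
    have h := hann U
    rw [hdim U hU, show 2 * k - k = k by omega] at h
    rw [← h, Finset.bipartiteAbove, Finset.filter_filter]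
    congr 1
    ext f
    simp only [Finset.mem_filter, Finset.mem_univ, true_and]
    exact ⟨fun h => ⟨h.1.1, h.2⟩, fun h => ⟨⟨h.1, (hPS U hU).trans h.2⟩, h.2⟩⟩
  rw [Finset.sum_congr rfl hleft, Finset.sum_const, smul_eq_mul] at hcount
  have hannP := hann P
  rw [hP] at hannP
  rw [hcount, ← hannP, mul_comm, ← smul_eq_mul]
  refine Finset.sum_le_card_nsmul _ _ _ fun f hf => ?_
  simp only [Finset.mem_filter, Finset.mem_univ, true_and] at hf
  exact ha f hf.1 hf.2

end PartialSpread

/-- In a `(2k,N,2k-2;k)_q` constant dimension code with `k ≥ 3`, every point lies on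
at most `q^k + 1` codewords. -/
theorem point_incidence_bound (K : Type*) [Field K] [Fintype K] (q k : ℕ)
    (hq : Fintype.card K = q) (hk : 3 ≤ k)
    (C : Set (Submodule K (Fin (2 * k) → K)))
    (hdim : ∀ U ∈ C, finrank K ↥U = k)
    (hdist : ∀ U ∈ C, ∀ W ∈ C, U ≠ W → 2 * k - 2 ≤ sDist U W)
    (P : Submodule K (Fin (2 * k) → K)) (hP : finrank K ↥P = 1) :
    {U ∈ C | P ≤ U}.ncard ≤ q ^ k + 1 := by
  classical
  have hfin : {U ∈ C | P ≤ U}.Finite := Set.toFinite _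
  rw [Set.ncard_eq_toFinset_card _ hfin]
  have hmem : ∀ U ∈ hfin.toFinset, U ∈ C ∧ P ≤ U := fun U hU => by simpa using hU
  by_contra! hlt
  subst hq
  have hV : finrank K (Fin (2 * k) → K) = 2 * k := by simp
  have hmul := card_mul_le_of_card_filter_le_ker_le hV hfin.toFinset P hP
    (fun U hU => hdim U (hmem U hU).1) (fun U hU => (hmem U hU).2) _
    (card_filter_le_ker_le hk hV hfin.toFinset P hP
      (fun U hU => hdim U (hmem U hU).1) (fun U hU => (hmem U hU).2)
      (fun U hU W hW hUW => inf_eq_of_le_sDist (by omega) (hdim U (hmem U hU).1)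
        (hdim W (hmem W hW).1) (hdist U (hmem U hU).1 W (hmem W hW).1 hUW) hP
        (hmem U hU).2 (hmem W hW).2) hlt)
  have hpow : Fintype.card K * Fintype.card K ^ (2 * k - 1) =
      Fintype.card K ^ k * Fintype.card K ^ k := by
    rw [← pow_succ', ← pow_add]; congr 1; omega
  have hq : 2 ≤ Fintype.card K := Fintype.one_lt_card
  have hx : Fintype.card K ≤ Fintype.card K ^ k := Nat.le_self_pow (by omega) _
  rw [Nat.mul_sub_one (Fintype.card K), hpow] at hmul
  generalize Fintype.card K ^ k = x at *
  obtain ⟨y, rfl⟩ : ∃ y, x = y + 1 := ⟨x - 1, by omega⟩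
  rw [Nat.add_sub_cancel] at hmul
  have hlow : (y + 3) * y ≤ (y + 1) * (y + 1) - Fintype.card K :=
    (Nat.mul_le_mul_right y hlt).trans hmul
  have hsq := Nat.add_le_of_le_sub (hx.trans (Nat.le_mul_self _)) hlow
  nlinarith
end

section
/- Let k ≥ 3, let q be a prime power, and let C be a set of k-dimensional subspaces of V = F_q^{2k} whose pairwise subspace distances are all at least 2k − 2. Then for every (2k−1)-dimensional subspace H of V we have #{U ∈ C : U ≤ H} ≤ q^k + 1. -/
open Module

/-- The number of nonzero elements of a subspace, as a sum of indicators. -/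
lemma sum_ite_ne_zero_mem {K V : Type*} [Field K] [Fintype K] [AddCommGroup V] [Module K V]
    [Fintype V] (X : Submodule K V) :
    open Classical in
    ∑ v : V, (if v ≠ 0 ∧ v ∈ X then (1 : ℤ) else 0) =
      (Fintype.card K : ℤ) ^ finrank K X - 1 := by
  classical
  have hX : ∑ v : V, (if v ∈ X then (1 : ℤ) else 0) = (Fintype.card K : ℤ) ^ finrank K X := by
    rw [Finset.sum_boole, ← Fintype.card_subtype]
    exact_mod_cast card_eq_pow_finrank (K := K) (V := X)
  have h0 : ∑ v : V, (if v = 0 then (1 : ℤ) else 0) = 1 := by simp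
  rw [← hX, ← h0, ← Finset.sum_sub_distrib]
  refine Finset.sum_congr rfl fun v _ => ?_
  by_cases hv : v = 0 <;> simp [hv]

/-- Sum over the nonzero vectors `v` of `X` of one minus the number of members of `S` containing
`v`. If the members of `S` are pairwise disjoint, this is the number of nonzero vectors of `X`
covered by none of them. -/
lemma sum_one_sub_sum_ite_mem {K V : Type*} [Field K] [Fintype K] [AddCommGroup V] [Module K V]
    [Fintype V] (S : Finset (Submodule K V)) (X : Submodule K V) :
    open Classical in
    ∑ v : V, (if v ≠ 0 ∧ v ∈ X then 1 - ∑ U ∈ S, (if v ∈ U then (1 : ℤ) else 0) else 0) =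
      (Fintype.card K : ℤ) ^ finrank K X - 1 -
        ∑ U ∈ S, ((Fintype.card K : ℤ) ^ finrank K ↥(U ⊓ X) - 1) := by
  classical
  simp_rw [← sum_ite_ne_zero_mem]
  rw [Finset.sum_comm, ← Finset.sum_sub_distrib]
  refine Finset.sum_congr rfl fun v _ => ?_
  by_cases h0 : v = 0
  · simp [h0]
  · by_cases hX : v ∈ X <;> simp [h0, hX]

/-- A functional that does not vanish on `U` cuts it in a hyperplane of `U`. -/
lemma finrank_inf_ker_add_one {K V : Type*} [Field K] [AddCommGroup V] [Module K V]
    [FiniteDimensional K V] (U : Submodule K V) (f : Dual K V) (h : ¬ U ≤ LinearMap.ker f) :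
    finrank K ↥(U ⊓ LinearMap.ker f) + 1 = finrank K U := by
  have hne : f.domRestrict U ≠ 0 := by
    intro h0
    exact h fun u hu => by simpa using LinearMap.congr_fun h0 ⟨u, hu⟩
  rw [← Module.Dual.finrank_ker_add_one_of_ne_zero hne]
  congr 1
  have : (LinearMap.ker (f.domRestrict U)).map U.subtype = U ⊓ LinearMap.ker f := by
    ext v
    simp [and_comm]
  rw [← this]
  exact (Submodule.equivMapOfInjective _ U.injective_subtype _).finrank_eq.symm

/-- A family of pairwise disjoint `t`-dimensional subspaces of a `(2t+1)`-dimensional space over a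
field with `q` elements cannot have exactly `q ^ (t+1) + 2` members, if `t ≥ 2`. -/
lemma partial_spread_card_ne {K V : Type*} [Field K] [Fintype K] [AddCommGroup V] [Module K V]
    [FiniteDimensional K V] {t : ℕ} (ht : 2 ≤ t) (hV : finrank K V = 2 * t + 1)
    (S : Finset (Submodule K V)) (hdim : ∀ U ∈ S, finrank K U = t)
    (hdisj : ∀ U ∈ S, ∀ W ∈ S, U ≠ W → U ⊓ W = ⊥) :
    S.card ≠ Fintype.card K ^ (t + 1) + 2 := by
  classical
  intro hcard
  have : Finite V := Module.finite_of_finite K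
  have : Finite (Dual K V) := Module.finite_of_finite K
  have := Fintype.ofFinite V
  have := Fintype.ofFinite (Dual K V)
  obtain ⟨s, rfl⟩ : ∃ s, t = s + 1 := ⟨t - 1, by omega⟩
  set Q : ℤ := (Fintype.card K : ℤ) with hQ
  have hQ2 : 2 ≤ Q := by rw [hQ]; exact_mod_cast Nat.succ_le_of_lt (Fintype.one_lt_card (α := K))
  have hS : (S.card : ℤ) = Q ^ (s + 2) + 2 := by rw [hcard]; push_cast; rfl
  have hP : 2 ≤ Q ^ s := hQ2.trans (le_self_pow₀ (by omega) (by omega))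
  set P : ℤ := Q ^ s with hPdef
  let w : V → ℤ := fun v => 1 - ∑ U ∈ S, (if v ∈ U then (1 : ℤ) else 0)
  have w_nonneg (v : V) (hv : v ≠ 0) : 0 ≤ w v := by
    have : (S.filter (v ∈ ·)).card ≤ 1 := by
      refine Finset.card_le_one.2 fun U hU W hW => ?_
      rw [Finset.mem_filter] at hU hW
      by_contra hne
      have : v ∈ U ⊓ W := ⟨hU.2, hW.2⟩
      rw [hdisj U hU.1 W hW.1 hne] at this
      exact hv (by simpa using this)
    simp only [w, Finset.sum_boole]
    have : ((S.filter (v ∈ ·)).card : ℤ) ≤ 1 := by exact_mod_cast this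
    linarith
  have total : ∑ v : V, (if v ≠ 0 then w v else 0) = Q ^ 2 * P - 2 * (Q * P) + 1 := by
    have hterm : ∀ U ∈ S, Q ^ finrank K ↥(U ⊓ ⊤ : Submodule K V) - 1 = Q ^ (s + 1) - 1 :=
      fun U hU => by rw [inf_top_eq, hdim U hU]
    have h := sum_one_sub_sum_ite_mem S (⊤ : Submodule K V)
    rw [Finset.sum_congr rfl hterm, Finset.sum_const, nsmul_eq_mul, hS] at h
    simp only [Submodule.mem_top, and_true, finrank_top, hV] at h
    refine h.trans ?_
    rw [← hQ, hPdef]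
    ring
  have lower (f : Dual K V) (hf : f ≠ 0) :
      P * (Q - 2) + 1 ≤ ∑ v : V, (if v ≠ 0 ∧ f v = 0 then w v else 0) := by
    have h := sum_one_sub_sum_ite_mem S (LinearMap.ker f)
    have hker : finrank K (LinearMap.ker f) = 2 * s + 2 := by
      have := Module.Dual.finrank_ker_add_one_of_ne_zero hf
      omega
    simp only [LinearMap.mem_ker] at h
    have hterm : ∀ U ∈ S, Q ^ finrank K ↥(U ⊓ LinearMap.ker f) - 1 =
        (P - 1) + (if U ≤ LinearMap.ker f then 1 else 0) * (P * (Q - 1)) := by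
      intro U hU
      by_cases hle : U ≤ LinearMap.ker f
      · rw [inf_eq_left.2 hle, hdim U hU, if_pos hle, hPdef]
        ring
      · have := finrank_inf_ker_add_one U f hle
        rw [hdim U hU] at this
        rw [Nat.succ_injective this, if_neg hle]
        ring
    rw [hker, Finset.sum_congr rfl hterm, Finset.sum_add_distrib, Finset.sum_const,
      nsmul_eq_mul, hS, ← Finset.sum_mul, Finset.sum_boole] at h
    set a : ℤ := ((S.filter (· ≤ LinearMap.ker f)).card : ℤ)
    have hval : ∑ v : V, (if v ≠ 0 ∧ f v = 0 then w v else 0) =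
        P * ((Q + 1 - a) * (Q - 1) - 1) + 1 := by
      refine h.trans ?_
      simp only [hPdef]
      ring
    have hnn : 0 ≤ ∑ v : V, (if v ≠ 0 ∧ f v = 0 then w v else 0) :=
      Finset.sum_nonneg fun v _ => by
        split_ifs with hv
        · exact w_nonneg v hv.1
        · exact le_rfl
    rw [hval] at hnn ⊢
    have hpos : 0 ≤ (Q + 1 - a) * (Q - 1) - 1 := by
      by_contra! hneg
      nlinarith
    have ha : 1 ≤ Q + 1 - a := by
      by_contra! hneg
      nlinarith
    nlinarith [mul_nonneg (sub_nonneg.2 ha) (by linarith : (0 : ℤ) ≤ Q - 1)]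
  have functionals (v : V) (hv : v ≠ 0) :
      ∑ f : Dual K V, (if f ≠ 0 ∧ f v = 0 then (1 : ℤ) else 0) = Q ^ (2 * s + 2) - 1 := by
    have hne : Dual.eval K V v ≠ 0 := by
      rwa [Ne, Module.eval_apply_eq_zero_iff]
    have hker : finrank K (LinearMap.ker (Dual.eval K V v)) = 2 * s + 2 := by
      have := Module.Dual.finrank_ker_add_one_of_ne_zero hne
      rw [Subspace.dual_finrank_eq] at this
      omega
    rw [← hker, ← sum_ite_ne_zero_mem]
    simp
  have double : ∑ f : Dual K V, (if f ≠ 0 then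
      ∑ v : V, (if v ≠ 0 ∧ f v = 0 then w v else 0) else 0) =
      (Q ^ (2 * s + 2) - 1) * (Q ^ 2 * P - 2 * (Q * P) + 1) := by
    rw [← total, Finset.mul_sum]
    calc _ = ∑ f : Dual K V, ∑ v : V, (if f ≠ 0 ∧ v ≠ 0 ∧ f v = 0 then w v else 0) := by
          refine Finset.sum_congr rfl fun f _ => ?_
          by_cases hf : f = 0 <;> simp [hf]
      _ = _ := by
          rw [Finset.sum_comm]
          refine Finset.sum_congr rfl fun v _ => ?_
          by_cases hv : v = 0
          · simp [hv]
          · rw [if_pos hv, ← functionals v hv, Finset.sum_mul]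
            refine Finset.sum_congr rfl fun f _ => ?_
            simp [hv]
  have bound : (Q ^ (2 * s + 3) - 1) * (P * (Q - 2) + 1) ≤
      (Q ^ (2 * s + 2) - 1) * (Q ^ 2 * P - 2 * (Q * P) + 1) := by
    have hcount : ∑ f : Dual K V, (if f ≠ 0 then (1 : ℤ) else 0) = Q ^ (2 * s + 3) - 1 := by
      have h := sum_ite_ne_zero_mem (⊤ : Submodule K (Dual K V))
      simp only [Submodule.mem_top, and_true, finrank_top, Subspace.dual_finrank_eq, hV] at h
      exact h
    rw [← double, ← hcount, Finset.sum_mul]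
    refine Finset.sum_le_sum fun f _ => ?_
    by_cases hf : f = 0
    · simp [hf]
    · simpa [hf] using lower f hf
  have e1 : Q ^ (2 * s + 3) = Q ^ 3 * P ^ 2 := by rw [hPdef]; ring
  have e2 : Q ^ (2 * s + 2) = Q ^ 2 * P ^ 2 := by rw [hPdef]; ring
  rw [e1, e2] at bound
  have h1 : 0 < Q ^ 2 * P ^ 2 * (Q - 1) := by
    have : 0 < Q - 1 := by linarith
    positivity
  have h2 : 0 ≤ (Q - 1) * (P * (Q - 2)) :=
    mul_nonneg (by linarith) (mul_nonneg (by linarith) (by linarith))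
  nlinarith

/-- In a `(2k,N,2k-2;k)_q` constant dimension code with `k ≥ 3`, every hyperplane contains
at most `q^k + 1` codewords. -/
theorem hyperplane_incidence_bound (K : Type*) [Field K] [Fintype K] (q k : ℕ)
    (hq : Fintype.card K = q) (hk : 3 ≤ k)
    (C : Set (Submodule K (Fin (2 * k) → K)))
    (hdim : ∀ U ∈ C, finrank K ↥U = k)
    (hdist : ∀ U ∈ C, ∀ W ∈ C, U ≠ W → 2 * k - 2 ≤ sDist U W)
    (H : Submodule K (Fin (2 * k) → K)) (hH : finrank K ↥H = 2 * k - 1) :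
    {U ∈ C | U ≤ H}.ncard ≤ q ^ k + 1 := by
  classical
  subst hq
  by_contra! hlt
  obtain ⟨T, hTC, hT⟩ := Set.exists_subset_card_eq (Nat.succ_le_of_lt hlt)
  have hTfin : T.Finite := Set.finite_of_ncard_ne_zero (by omega)
  let φ : Submodule K (Fin (2 * k) → K) → Submodule K (Dual K H) :=
    fun U => (U.submoduleOf H).dualAnnihilator
  have sup_eq_top : ∀ U ∈ T, ∀ W ∈ T, U ≠ W → U ⊔ W = H := by
    intro U hU W hW hne
    have hd := hdist U (hTC hU).1 W (hTC hW).1 hne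
    have hadd := Submodule.finrank_sup_add_finrank_inf_eq U W
    rw [hdim U (hTC hU).1, hdim W (hTC hW).1] at hadd
    have hle : U ⊔ W ≤ H := sup_le (hTC hU).2 (hTC hW).2
    refine Submodule.eq_of_le_of_finrank_le hle ?_
    unfold sDist at hd
    omega
  have φ_disj : ∀ U ∈ T, ∀ W ∈ T, U ≠ W → φ U ⊓ φ W = ⊥ := by
    intro U hU W hW hne
    rw [← Submodule.dualAnnihilator_sup_eq, ← Submodule.submoduleOf_sup_of_le (hTC hU).2 (hTC hW).2,
      sup_eq_top U hU W hW hne, Submodule.submoduleOf_self, Submodule.dualAnnihilator_top]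
  have φ_finrank : ∀ U ∈ T, finrank K (φ U) = k - 1 := by
    intro U hU
    have h1 := Subspace.finrank_add_finrank_dualAnnihilator_eq (U.submoduleOf H)
    have h2 := (Submodule.submoduleOfEquivOfLe (hTC hU).2).finrank_eq
    rw [hdim U (hTC hU).1] at h2
    simp only [φ]
    omega
  have φ_inj : Set.InjOn φ T := by
    intro U hU W hW heq
    by_contra hne
    have h0 := φ_disj U hU W hW hne
    rw [← heq, inf_idem] at h0
    have h1 := φ_finrank U hU
    rw [h0, finrank_bot] at h1
    omega
  refine partial_spread_card_ne (K := K) (V := Dual K H) (t := k - 1) (by omega)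
    (by rw [Subspace.dual_finrank_eq, hH]; omega) (hTfin.toFinset.image φ) ?_ ?_ ?_
  · simpa using φ_finrank
  · simp only [Finset.mem_image, Set.Finite.mem_toFinset]
    rintro _ ⟨U, hU, rfl⟩ _ ⟨W, hW, rfl⟩ hne
    exact φ_disj U hU W hW fun h => hne (h ▸ rfl)
  · rw [Finset.card_image_of_injOn (by simpa using φ_inj), ← Set.ncard_eq_toFinset_card T hTfin, hT,
      Nat.sub_add_cancel (by omega)]
end

section
/- Let k ≥ 3, let q be a prime power, let c be a natural number, and let C be a set of k-dimensional subspaces of V = F_q^{2k} whose pairwise subspace distances are all at least 2k − 2, with N = |C|. If 2N > (q^k + 1)·(2(q^k + 1) − (c + 1)), then there exist a hyperplane H̄ (a (2k−1)-dimensional subspace) and a point P̄ (a 1-dimensional subspace) with P̄ not contained in H̄ such that #{U ∈ C : U ≤ H̄} + #{U ∈ C : P̄ ≤ U} ≥ 2(q^k + 1) − c. -/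
open Module

/-- A nonzero linear form on a finite space is nonzero at exactly `q^n - q^(n-1)` vectors. -/
theorem card_filter_apply_ne_zero {K Y : Type*} [Field K] [Fintype K] [DecidableEq K]
    [AddCommGroup Y] [Module K Y] [Fintype Y] {g : Y →ₗ[K] K} (hg : g ≠ 0) :
    (Finset.univ.filter fun y => g y ≠ 0).card =
      Fintype.card K ^ finrank K Y - Fintype.card K ^ (finrank K Y - 1) := by
  have hker : (Finset.univ.filter fun y => g y = 0).card =
      Fintype.card K ^ (finrank K Y - 1) := by
    have hrank : finrank K (LinearMap.ker g) = finrank K Y - 1 := by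
      have := Module.Dual.finrank_ker_add_one_of_ne_zero (f := g) hg
      omega
    rw [← hrank, ← Nat.card_eq_fintype_card, ← Module.natCard_eq_pow_finrank,
      ← Nat.subtype_card (p := fun y => y ∈ LinearMap.ker g)]
    simp
  have hsum := Finset.card_filter_add_card_filter_not (s := Finset.univ) (fun y => g y = 0)
  rw [Finset.card_univ, Module.card_eq_pow_finrank (K := K) (V := Y), hker] at hsum
  exact (Nat.sub_eq_of_eq_add' hsum.symm).symm

/-- For an injective pairing `B : X → Y → K`, count the pairs `(x, y)` with `x` in a given
subspace and `B x y ≠ 0`. -/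
theorem card_filter_mem_pairing_ne_zero {K X Y : Type*} [Field K] [Fintype K] [DecidableEq K]
    [AddCommGroup X] [Module K X] [Fintype X] [AddCommGroup Y] [Module K Y] [Fintype Y]
    (B : X →ₗ[K] Y →ₗ[K] K) (hB : Function.Injective B)
    (U : Submodule K X) [DecidablePred (· ∈ U)] :
    (Finset.univ.filter fun p : X × Y => p.1 ∈ U ∧ B p.1 p.2 ≠ 0).card =
      (Fintype.card K ^ finrank K U - 1) *
        (Fintype.card K ^ finrank K Y - Fintype.card K ^ (finrank K Y - 1)) := by
  classical
  have hU : ((Finset.univ.filter (· ∈ U)).erase 0).card = Fintype.card K ^ finrank K U - 1 := by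
    rw [Finset.card_erase_of_mem (by simp), ← Nat.card_eq_fintype_card (α := K),
      ← Module.natCard_eq_pow_finrank,
      ← Nat.subtype_card (p := fun y => y ∈ U) (Finset.univ.filter (· ∈ U)) (by simp)]
  rw [← hU, Finset.card_eq_sum_card_fiberwise (f := Prod.fst)
    (t := (Finset.univ.filter (· ∈ U)).erase 0), Finset.sum_const_nat]
  · intro x hx
    simp only [Finset.mem_erase, Finset.mem_filter, Finset.mem_univ, true_and] at hx
    rw [← card_filter_apply_ne_zero (g := B x) (by simpa using hB.ne hx.1)]
    refine Finset.card_bij' (fun p _ => p.2) (fun y _ => (x, y)) ?_ ?_ ?_ ?_ <;>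
      grind
  · rintro ⟨x, y⟩ h
    simp only [Finset.coe_filter, Finset.mem_univ, true_and, Set.mem_ofPred_eq] at h
    simp only [Finset.coe_erase, Finset.coe_filter, Finset.mem_univ, true_and, Set.mem_sdiff,
      Set.mem_ofPred_eq, Set.mem_singleton_iff]
    refine ⟨h.1, fun hx => h.2 ?_⟩
    simp [hx]

/-- Averaging over all pairs of a linear form and a vector on which it does not vanish: a large
family of `k`-dimensional subspaces of a `2k`-dimensional space has a non-incident
point–hyperplane pair incident with many of its members. -/
theorem exists_heavy_point_hyperplane_of_finrank {K V : Type*} [Field K] [Fintype K]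
    [AddCommGroup V] [Module K V] [Fintype V] {q k c N : ℕ}
    (hq : Fintype.card K = q) (hk : 0 < k) (hV : finrank K V = 2 * k)
    (C : Set (Submodule K V)) (hN : N = C.ncard) (hdim : ∀ U ∈ C, finrank K ↥U = k)
    (hbig : 2 * N > (q ^ k + 1) * (2 * (q ^ k + 1) - (c + 1))) :
    ∃ H P : Submodule K V,
      finrank K ↥H = 2 * k - 1 ∧ finrank K ↥P = 1 ∧ ¬ P ≤ H ∧
      2 * (q ^ k + 1) - c ≤ {U ∈ C | U ≤ H}.ncard + {U ∈ C | P ≤ U}.ncard := by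
  classical
  have : Finite (Dual K V) := Module.finite_of_finite K
  let : Fintype (Dual K V) := Fintype.ofFinite _
  have : Finite (Submodule K V) := Finite.of_injective _ SetLike.coe_injective
  obtain ⟨D, rfl⟩ : ∃ D : Finset (Submodule K V), (D : Set (Submodule K V)) = C :=
    ⟨C.toFinite.toFinset, by simp⟩
  rw [Set.ncard_coe_finset] at hN
  simp only [Finset.mem_coe] at hdim ⊢
  by_contra! hcon
  let S : Finset (Dual K V × V) := Finset.univ.filter fun p => p.1 p.2 ≠ 0
  set δ := q ^ (2 * k) - q ^ (2 * k - 1) with hδ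
  have hS : S.card = (q ^ (2 * k) - 1) * δ := by
    have h := card_filter_mem_pairing_ne_zero (LinearMap.id : Dual K V →ₗ[K] V →ₗ[K] K)
      Function.injective_id ⊤
    simpa [S, hq, hV, hδ, Subspace.dual_finrank_eq] using h
  have hHyper : ∀ U ∈ D, (S.filter fun p => U ≤ LinearMap.ker p.1).card = (q ^ k - 1) * δ := by
    intro U hU
    have h := card_filter_mem_pairing_ne_zero (LinearMap.id : Dual K V →ₗ[K] V →ₗ[K] K)
      Function.injective_id U.dualAnnihilator
    have hr : finrank K U.dualAnnihilator = k := by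
      have h1 := Subspace.finrank_add_finrank_dualAnnihilator_eq U
      have h2 := hdim U hU
      omega
    rw [hr, hq, hV] at h
    rw [hδ, ← h, Finset.filter_filter]
    congr 1
    ext p
    simp [Submodule.mem_dualAnnihilator, SetLike.le_def, and_comm]
  have hPoint : ∀ U ∈ D, (S.filter fun p => p.2 ∈ U).card = (q ^ k - 1) * δ := by
    intro U hU
    have h := card_filter_mem_pairing_ne_zero (Dual.eval K V)
      (Module.eval_apply_injective K) U
    rw [hdim U hU, hq, Subspace.dual_finrank_eq, hV] at h
    rw [hδ, ← h, Finset.filter_filter]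
    refine Finset.card_equiv (Equiv.prodComm _ _) fun p => ?_
    rw [Finset.mem_filter, Finset.mem_filter]
    simp [and_comm]
  set M := 2 * (q ^ k + 1) - (c + 1) with hM
  have hle : ∀ p ∈ S, (D.filter fun U => U ≤ LinearMap.ker p.1).card +
      (D.filter fun U => p.2 ∈ U).card ≤ M := by
    rintro ⟨f, v⟩ hp
    replace hp : f v ≠ 0 := by simpa [S] using hp
    have hf : f ≠ 0 := by rintro rfl; simp at hp
    have hv : v ≠ 0 := by rintro rfl; simp at hp
    have hr : finrank K (LinearMap.ker f) = 2 * k - 1 := by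
      have := Module.Dual.finrank_ker_add_one_of_ne_zero (f := f) hf
      omega
    have h := hcon (LinearMap.ker f) (K ∙ v) hr (finrank_span_singleton hv) (by simpa using hp)
    simp only [Submodule.span_singleton_le_iff_mem, ← Finset.coe_filter,
      Set.ncard_coe_finset] at h
    simp only
    omega
  have hsum := Finset.sum_le_card_nsmul S _ M hle
  have h1 := Finset.sum_card_bipartiteAbove_eq_sum_card_bipartiteBelow (s := S) (t := D)
    (fun p U => U ≤ LinearMap.ker p.1)
  have h2 := Finset.sum_card_bipartiteAbove_eq_sum_card_bipartiteBelow (s := S) (t := D)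
    (fun p U => p.2 ∈ U)
  simp only [Finset.bipartiteAbove, Finset.bipartiteBelow] at h1 h2
  rw [Finset.sum_add_distrib, h1, h2, Finset.sum_const_nat hHyper, Finset.sum_const_nat hPoint,
    hS, ← hN, smul_eq_mul] at hsum
  have hq2 : 1 < q := hq ▸ Fintype.one_lt_card
  have hδpos : 0 < δ := Nat.sub_pos_of_lt (Nat.pow_lt_pow_right hq2 (by omega))
  have hqk : 0 < q ^ k - 1 := Nat.sub_pos_of_lt (Nat.one_lt_pow (by omega) hq2)
  have hfac : q ^ (2 * k) - 1 = (q ^ k + 1) * (q ^ k - 1) := by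
    rw [← Nat.sq_sub_sq, one_pow, ← pow_mul, mul_comm]
  rw [hfac] at hsum
  nlinarith [Nat.mul_lt_mul_of_pos_right hbig (Nat.mul_pos hqk hδpos)]

/-- If a `(2k,N,2k-2;k)_q` constant dimension code (`k ≥ 3`) satisfies
`N > (q^k+1)(q^k+1 - (c+1)/2)`, then some non-incident point–hyperplane pair is
incident with at least `2(q^k+1) - c` codewords in total. -/
theorem exists_heavy_point_hyperplane (K : Type*) [Field K] [Fintype K] (q k c N : ℕ)
    (hq : Fintype.card K = q) (hk : 3 ≤ k)
    (C : Set (Submodule K (Fin (2 * k) → K))) (hN : N = C.ncard)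
    (hdim : ∀ U ∈ C, finrank K ↥U = k)
    (hdist : ∀ U ∈ C, ∀ W ∈ C, U ≠ W → 2 * k - 2 ≤ sDist U W)
    (hbig : 2 * N > (q ^ k + 1) * (2 * (q ^ k + 1) - (c + 1))) :
    ∃ H P : Submodule K (Fin (2 * k) → K),
      finrank K ↥H = 2 * k - 1 ∧ finrank K ↥P = 1 ∧ ¬ P ≤ H ∧
      2 * (q ^ k + 1) - c ≤ {U ∈ C | U ≤ H}.ncard + {U ∈ C | P ≤ U}.ncard := by
  exact exists_heavy_point_hyperplane_of_finrank hq (by omega) (by simp) C hN hdim hbig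
end

section
/- For all natural numbers q ≥ 2, k ≥ 3, M, and N such that M·(q^{k−1} − 1) ≤ q^{2k} − 1 and N ≥ q^{2k} + 1, one has ⌊(q^{2k+1} − 1)·M / (q^k − 1)⌋ < ⌊(q^{2k+1} − 1)·N / (q^{k+1} − 1)⌋, where ⌊·/·⌋ denotes natural-number (floor) division. -/
theorem johnson_polynomial_bound (q a : ℤ) (hq : 2 ≤ q) (ha : q ^ 2 ≤ a) :
    (q * a + 2) * (q ^ 2 * a - 1) ≤ (q ^ 2 * a ^ 2 + 1) * (a - 1) := by
  obtain ⟨t, rfl⟩ : ∃ t, q = 2 + t := ⟨q - 2, by ring⟩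
  obtain ⟨s, rfl⟩ : ∃ s, a = (2 + t) ^ 2 + s := ⟨a - (2 + t) ^ 2, by ring⟩
  have ht : 0 ≤ t := by linarith
  have hs : 0 ≤ s := by linarith
  rw [← sub_nonneg]
  ring_nf
  positivity

theorem Nat.div_lt_div_of_add_mul_le {x y b c : ℕ} (hb : 0 < b) (hc : 0 < c)
    (h : (x + b) * c ≤ y * b) : x / b < y / c := by
  rw [← Nat.add_one_le_iff, Nat.le_div_iff_mul_le hc]
  refine Nat.le_of_mul_le_mul_right ?_ hb
  calc (x / b + 1) * c * b = (x / b * b + b) * c := by ring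
    _ ≤ (x + b) * c := by gcongr; exact Nat.div_mul_le_self x b
    _ ≤ y * b := h

/-- The Johnson-type bound via `M = A_q(2k,2k-2;k-1)` is always strictly smaller than the
one via `N = A_q(2k,2k-2;k)`. -/
theorem johnson_comparison (q k M N : ℕ) (hq : 2 ≤ q) (hk : 3 ≤ k)
    (hM : M * (q ^ (k - 1) - 1) ≤ q ^ (2 * k) - 1)
    (hN : q ^ (2 * k) + 1 ≤ N) :
    (q ^ (2 * k + 1) - 1) * M / (q ^ k - 1) < (q ^ (2 * k + 1) - 1) * N / (q ^ (k + 1) - 1) := by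
  have one_lt_qpow {n : ℕ} (hn : n ≠ 0) : 1 < q ^ n := Nat.one_lt_pow hn hq
  have hb := one_lt_qpow (n := k) (by omega)
  have hc := one_lt_qpow (n := k + 1) (by omega)
  have ha := one_lt_qpow (n := k - 1) (by omega)
  have hp := one_lt_qpow (n := 2 * k + 1) (by omega)
  have hd := one_lt_qpow (n := 2 * k) (by omega)
  apply Nat.div_lt_div_of_add_mul_le (by omega) (by omega)
  have hqa : q ^ 2 ≤ q ^ (k - 1) := Nat.pow_le_pow_right (by omega) (by omega)
  obtain ⟨j, rfl⟩ : ∃ j, k = j + 1 := ⟨k - 1, by omega⟩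
  simp only [Nat.add_sub_cancel] at hM ha hqa
  zify [hb.le, hc.le, ha.le, hp.le, hd.le] at *
  rw [show (q : ℤ) ^ (2 * (j + 1)) = q ^ 2 * (q ^ j) ^ 2 by ring] at hM hN
  rw [show (q : ℤ) ^ (2 * (j + 1) + 1) = q ^ 3 * (q ^ j) ^ 2 by ring] at hp ⊢
  rw [show (q : ℤ) ^ (j + 1) = q * q ^ j by ring] at hb ⊢
  rw [show (q : ℤ) ^ (j + 1 + 1) = q ^ 2 * q ^ j by ring] at hc ⊢
  generalize (q : ℤ) ^ j = a at *
  generalize (q : ℤ) = q at *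
  generalize (M : ℤ) = M at *
  generalize (N : ℤ) = N at *
  have hpoly := johnson_polynomial_bound q a hq hqa
  have haP : a - 1 ≤ q ^ 3 * a ^ 2 - 1 := by
    have : 1 ≤ q ^ 3 * a := one_le_mul_of_one_le_of_one_le (one_le_pow₀ (by linarith)) ha.le
    nlinarith
  have hB : 0 ≤ q * a - 1 := by linarith
  have hC : 0 ≤ q ^ 2 * a - 1 := by linarith
  have hP : 0 ≤ q ^ 3 * a ^ 2 - 1 := by linarith
  have hA : 0 < a - 1 := by linarith
  generalize hPdef : q ^ 3 * a ^ 2 - 1 = P at *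
  refine le_of_mul_le_mul_right ?_ hA
  calc (P * M + (q * a - 1)) * (q ^ 2 * a - 1) * (a - 1)
      = (P * (M * (a - 1)) + (q * a - 1) * (a - 1)) * (q ^ 2 * a - 1) := by ring
    _ ≤ (P * (q ^ 2 * a ^ 2 - 1) + (q * a - 1) * P) * (q ^ 2 * a - 1) := by gcongr
    _ = P * (q * a - 1) * ((q * a + 2) * (q ^ 2 * a - 1)) := by ring
    _ ≤ P * (q * a - 1) * ((q ^ 2 * a ^ 2 + 1) * (a - 1)) := by gcongr
    _ ≤ P * (q * a - 1) * (N * (a - 1)) := by gcongr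
    _ = P * N * (q * a - 1) * (a - 1) := by ring
end
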